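/- In the ABC protocol, let G be a minimal transaction DAG containing two confirmed conflicting transactions, and let t_0 be the first transaction confirmed in G during the execution (with respect to a fixed total order <_time of messages respecting message dependence). Then for any confirmed transaction t in G, either t_0 \u2208 past(A_t) or t \u2208 past(A_{t_0}) holds, where A_t and A_{t_0} are the respective confirming ack sets. -/

import Mathlib

open scoped Classical

/-- An abstract model of a message DAG produced by the ABC protocol.
Transactions, acks and outputs form the messages of the DAG; every output
carries a value and is delegated to a validator; transactions spend outputs
of previous transactions; acks are issued by validators and sign transactions;
messages reference each other acyclically. -/
structure ABC where
  /-- agents / validators -/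
  Val : Type
  /-- transactions of the DAG -/
  Tx : Type
  /-- acks of the DAG -/
  Ack : Type
  /-- transaction outputs -/
  Out : Type
  [fintypeTx : Fintype Tx]
  [fintypeAck : Fintype Ack]
  [fintypeOut : Fintype Out]
  /-- the total money in the system -/
  M : ℚ
  /-- the value (money amount) of an output -/
  value : Out → ℚ
  value_nonneg : ∀ o, 0 ≤ value o
  /-- the (unique) transaction of which `o` is an output -/
  producer : Out → Tx
  /-- `spends t o` : output `o` is an input of transaction `t` -/
  spends : Tx → Out → Prop
  /-- the validator key indicated in a transaction -/
  txValidator : Tx → Val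
  /-- the validator to which an output delegates its stake -/
  delegatedTo : Out → Val
  /-- the genesis transaction -/
  genesis : Tx
  /-- the genesis has no inputs -/
  genesis_no_inputs : ∀ o, ¬ spends genesis o
  /-- outputs of a non-genesis transaction are delegated to the validator
  indicated in the transaction (genesis outputs list the initial validators) -/
  delegated_eq : ∀ o, producer o ≠ genesis → delegatedTo o = txValidator (producer o)
  /-- the output values of a non-genesis transaction sum to its input values -/
  value_conserved : ∀ t, t ≠ genesis →
    (∑ o : Out, if producer o = t then value o else 0) =
      ∑ o : Out, if spends t o then value o else 0
  /-- the genesis output values sum to the total money `M` -/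
  genesis_M : (∑ o : Out, if producer o = genesis then value o else 0) = M
  /-- the validator that issued an ack -/
  ackValidator : Ack → Val
  /-- the set of transactions an ack signs -/
  ackSigns : Ack → Tx → Prop
  /-- hash references between messages (`Sum.inl` = transaction, `Sum.inr` = ack) -/
  ref : Tx ⊕ Ack → Tx ⊕ Ack → Prop
  /-- a transaction references the transactions producing its inputs -/
  ref_inputs : ∀ t o, spends t o → ref (Sum.inl t) (Sum.inl (producer o))
  /-- an ack references the transactions it signs -/
  ref_signs : ∀ a t, ackSigns a t → ref (Sum.inr a) (Sum.inl t)
  /-- the references form a DAG -/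
  ref_acyclic : ∀ m, ¬ Relation.TransGen ref m m
  /-- which agents are honest (the remaining ones form the adversary) -/
  honest : Val → Prop

attribute [instance] ABC.fintypeTx ABC.fintypeAck ABC.fintypeOut

namespace ABC

variable (P : ABC)

/-- messages: transactions and acks -/
abbrev Msg := P.Tx ⊕ P.Ack

/-- `past m` : the set of messages reachable from `m` by following references -/
def past (m : P.Msg) : Set P.Msg := {m' | Relation.ReflTransGen P.ref m m'}

/-- the past of a set of acks -/
def pastA (A : Finset P.Ack) : Set P.Msg := ⋃ a ∈ A, P.past (Sum.inr a)

/-- output `o` is spent in the message set `S` -/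
def SpentIn (S : Set P.Msg) (o : P.Out) : Prop :=
  ∃ t, (Sum.inl t : P.Msg) ∈ S ∧ P.spends t o

/-- `Depends t' t` : transaction `t'` depends on `t`
(reflexive-transitive closure of spending an output of) -/
def Depends : P.Tx → P.Tx → Prop :=
  Relation.ReflTransGen fun t' t => ∃ o, P.spends t' o ∧ P.producer o = t

/-- two transactions share an input -/
def SharesInput (t t' : P.Tx) : Prop := ∃ o, P.spends t o ∧ P.spends t' o

/-- conflicting transactions: two distinct transactions spending a common output
conflict, and conflicts propagate to all transactions depending on them -/
def Conflict (t₁ t₂ : P.Tx) : Prop :=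
  ∃ u₁ u₂, P.Depends t₁ u₁ ∧ P.Depends t₂ u₂ ∧ u₁ ≠ u₂ ∧ P.SharesInput u₁ u₂

/-- the stake delegated to validator `v` in the message set `S`, computed with
respect to a set `C` of (confirmed) transactions: the total value of outputs
of transactions in `C` delegated to `v` and unspent in `S` -/
noncomputable def stakeWith (C : Set P.Tx) (S : Set P.Msg) (v : P.Val) : ℚ :=
  ∑ o : P.Out,
    if P.producer o ∈ C ∧ P.delegatedTo o = v ∧ ¬ P.SpentIn S o then P.value o else 0

/-- `ConfirmedIn S t` : transaction `t` is confirmed using acks present in the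
message set `S`.  The genesis is confirmed from the start; a transaction `t` is
confirmed if the transactions producing its inputs are confirmed and there is a
set of acks `A` (in `S`) whose issuing validators sign `t` and together have
more than `2/3·M` stake delegated in `past A` (stake being computed from
transactions confirmed in `past A`, which is witnessed by the
under-approximation `C` — by nonnegativity of values this is equivalent to the
exact stake exceeding the threshold), and no other transaction in `past A`
shares an input with `t`. -/
inductive ConfirmedIn : Set P.Msg → P.Tx → Prop
  | genesis (S : Set P.Msg) : ConfirmedIn S P.genesis
  | confirm (S : Set P.Msg) (t : P.Tx) (A : Finset P.Ack) (C : Set P.Tx)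
      (hacks : ∀ a ∈ A, (Sum.inr a : P.Msg) ∈ S)
      (hinp : ∀ o, P.spends t o → ConfirmedIn S (P.producer o))
      (hsign : ∀ a ∈ A, P.ackSigns a t)
      (hC : ∀ u ∈ C, ConfirmedIn (P.pastA A) u)
      (hstake : (2 / 3 : ℚ) * P.M <
        ∑ v ∈ A.image P.ackValidator, P.stakeWith C (P.pastA A) v)
      (hnoconf : ∀ t', (Sum.inl t' : P.Msg) ∈ P.pastA A → t' ≠ t → ¬ P.SharesInput t t') :
      ConfirmedIn S t

/-- a transaction is confirmed (in the full DAG) -/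
def Confirmed (t : P.Tx) : Prop := P.ConfirmedIn Set.univ t

/-- the stake delegated to validator `v` in the message set `S`
(Definition "delegated stake" of the paper) -/
noncomputable def stake (S : Set P.Msg) (v : P.Val) : ℚ :=
  P.stakeWith {u | P.ConfirmedIn S u} S v

/-- `A` is a confirming ack set for `t` (the set `A_t` of the paper) -/
def ConfirmsVia (A : Finset P.Ack) (t : P.Tx) : Prop :=
  (∀ o, P.spends t o → P.Confirmed (P.producer o)) ∧
  (∀ a ∈ A, P.ackSigns a t) ∧
  (∃ C : Set P.Tx, (∀ u ∈ C, P.ConfirmedIn (P.pastA A) u) ∧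
    (2 / 3 : ℚ) * P.M < ∑ v ∈ A.image P.ackValidator, P.stakeWith C (P.pastA A) v) ∧
  (∀ t', (Sum.inl t' : P.Msg) ∈ P.pastA A → t' ≠ t → ¬ P.SharesInput t t')

/-- a view: a set of messages closed under references (an agent processes a
message only after having received its whole past) -/
def IsView (V : Set P.Msg) : Prop := ∀ m ∈ V, ∀ m', P.ref m m' → m' ∈ V

/-- honest validators chain their acks: any two acks of an honest validator
are related by references (each ack references the previous one) -/
def HonestChained : Prop :=
  ∀ a₁ a₂ : P.Ack, P.honest (P.ackValidator a₁) → P.ackValidator a₁ = P.ackValidator a₂ →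
    Relation.ReflTransGen P.ref (Sum.inr a₁) (Sum.inr a₂) ∨
      Relation.ReflTransGen P.ref (Sum.inr a₂) (Sum.inr a₁)

/-- an honest validator signs at most one of any pair of conflicting transactions -/
def HonestNoConflictSign : Prop :=
  ∀ a₁ a₂ t₁ t₂, P.honest (P.ackValidator a₁) → P.ackValidator a₁ = P.ackValidator a₂ →
    P.ackSigns a₁ t₁ → P.ackSigns a₂ t₂ → t₁ ≠ t₂ → ¬ P.Conflict t₁ t₂

/-- an execution order: a total ordering of the messages (given by injective
time stamps) respecting message dependence -/
structure Execution where
  time : P.Msg → ℕ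
  inj : Function.Injective time
  respects : ∀ m m', P.ref m m' → time m' < time m

/-- the messages issued up to time `n` in execution `E` -/
def prefixAt (E : P.Execution) (n : ℕ) : Set P.Msg := {m | E.time m ≤ n}

/-- the value of a transaction: the sum of the values of its outputs -/
noncomputable def txValue (t : P.Tx) : ℚ :=
  ∑ o : P.Out, if P.producer o = t then P.value o else 0

/-- the total value of the inputs of `t` that are outputs delegated to the
adversary (the quantity `m_{t,A}` of the paper) -/
noncomputable def advInputValue (t : P.Tx) : ℚ :=
  ∑ o : P.Out, if P.spends t o ∧ ¬ P.honest (P.delegatedTo o) then P.value o else 0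

/-- the paper's adversary-stake accounting, at the set `S` of messages issued
so far: the genesis outputs delegated to the adversary, minus `m_{t,A}` for
every honestly delegated transaction `t` already confirmed, plus
`m_t - m_{t,A}` for every adversary-delegated transaction `t` already issued -/
noncomputable def advStake (S : Set P.Msg) : ℚ :=
  (∑ o : P.Out,
      if P.producer o = P.genesis ∧ ¬ P.honest (P.delegatedTo o) then P.value o else 0)
    - (∑ t : P.Tx,
        if t ≠ P.genesis ∧ P.honest (P.txValidator t) ∧ P.ConfirmedIn S t
        then P.advInputValue t else 0)
    + ∑ t : P.Tx,
        if t ≠ P.genesis ∧ ¬ P.honest (P.txValidator t) ∧ (Sum.inl t : P.Msg) ∈ S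
        then P.txValue t - P.advInputValue t else 0

/-- at any time, less than one-third of the total money is delegated to the
adversary -/
def AdvBounded (E : P.Execution) : Prop :=
  ∀ n : ℕ, P.advStake (P.prefixAt E n) < P.M / 3

/-- the DAG can be produced by the protocol: honest validators chain their
acks and never sign conflicting transactions, and the adversary's stake stays
below `M/3` throughout some execution producing the DAG -/
def Producible : Prop :=
  P.HonestChained ∧ P.HonestNoConflictSign ∧ ∃ E : P.Execution, P.AdvBounded E

/-- the DAG contains two confirmed conflicting transactions -/
def HasDoubleSpend : Prop :=
  ∃ t₁ t₂, P.Confirmed t₁ ∧ P.Confirmed t₂ ∧ P.Conflict t₁ t₂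

/-- the time of the latest ack of the ack set `A` -/
noncomputable def latestAck (E : P.Execution) (A : Finset P.Ack) : ℕ :=
  A.sup fun a => E.time (Sum.inr a)

/-- `t₀` is the first transaction confirmed during the execution `E`,
exhibited by the confirming ack set `A₀` whose latest ack is minimal -/
def FirstConfirmed (E : P.Execution) (t₀ : P.Tx) (A₀ : Finset P.Ack) : Prop :=
  t₀ ≠ P.genesis ∧ P.ConfirmsVia A₀ t₀ ∧
    ∀ (t : P.Tx) (A : Finset P.Ack), t ≠ P.genesis → P.ConfirmsVia A t →
      P.latestAck E A₀ ≤ P.latestAck E A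

/-- a transaction is accepted (by an honest agent) if it is confirmed in some
view -/
def Accepted (t : P.Tx) : Prop := ∃ V, P.IsView V ∧ P.ConfirmedIn V t

/-- Agreement: a transaction confirmed in the view of some honest agent is
confirmed in the view of any honest agent having received (at least) the same
messages — the acks `A_t` are a transferable proof of confirmation, so every
honest agent will accept the same transaction — and no two conflicting
transactions are ever accepted -/
def Agreement : Prop :=
  (∀ (t : P.Tx) (V V' : Set P.Msg), P.IsView V → P.IsView V' → V ⊆ V' →
      P.ConfirmedIn V t → P.ConfirmedIn V' t) ∧
    ∀ t t', P.Conflict t t' → ¬ (P.Accepted t ∧ P.Accepted t')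

/-- Validity: a transaction without any conflicting transaction is accepted by
the honest agents (it is confirmed once all messages are delivered) -/
def Validity : Prop :=
  ∀ t : P.Tx, (∀ t', t' ≠ t → ¬ P.Conflict t t') → P.Confirmed t

/-- Honest-Termination: if a transaction without any conflicting transaction is
observed by an honest agent, then after receiving further messages the agent
accepts it -/
def HonestTermination : Prop :=
  ∀ t : P.Tx, (∀ t', t' ≠ t → ¬ P.Conflict t t') →
    ∀ V, P.IsView V → (Sum.inl t : P.Msg) ∈ V →
      ∃ V', P.IsView V' ∧ V ⊆ V' ∧ P.ConfirmedIn V' t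

/-- every honest validator signs every transaction that has no conflicting
alternative -/
def HonestRespond : Prop :=
  ∀ t : P.Tx, (∀ t', t' ≠ t → ¬ P.Conflict t t') →
    ∀ v, P.honest v → ∃ a, P.ackValidator a = v ∧ P.ackSigns a t

end ABC

namespace ABC

theorem sum_sub_eq {α : Type} [Fintype α] (p : α → Prop) [Fintype {x // p x}] (f : α → ℚ)
    (h : ∀ x, ¬ p x → f x = 0) : ∑ x : {x // p x}, f x.1 = ∑ x, f x := by
  rw [← Finset.sum_subtype (Finset.univ.filter p) (p := p) (by simp) f, Finset.sum_filter]
  refine Finset.sum_congr rfl fun x _ => ?_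
  split_ifs with hx
  · rfl
  · exact (h x hx).symm

variable (P : ABC)

/-- ranked confirmation -/
def ConfN : ℕ → Set P.Msg → P.Tx → Prop
  | 0, _, t => t = P.genesis
  | n + 1, S, t => t = P.genesis ∨ ∃ (A : Finset P.Ack) (C : Set P.Tx),
      (∀ a ∈ A, (Sum.inr a : P.Msg) ∈ S) ∧
      (∀ o, P.spends t o → ConfN n S (P.producer o)) ∧
      (∀ a ∈ A, P.ackSigns a t) ∧
      (∀ u ∈ C, ConfN n (P.pastA A) u) ∧
      ((2 / 3 : ℚ) * P.M < ∑ v ∈ A.image P.ackValidator, P.stakeWith C (P.pastA A) v) ∧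
      (∀ t', (Sum.inl t' : P.Msg) ∈ P.pastA A → t' ≠ t → ¬ P.SharesInput t t')

/-- ranked confirming ack set -/
def ViaN (n : ℕ) (A : Finset P.Ack) (t : P.Tx) : Prop :=
  (∀ a ∈ A, P.ackSigns a t) ∧
  (∃ C : Set P.Tx, (∀ u ∈ C, P.ConfN n (P.pastA A) u) ∧
    (2 / 3 : ℚ) * P.M < ∑ v ∈ A.image P.ackValidator, P.stakeWith C (P.pastA A) v) ∧
  (∀ t', (Sum.inl t' : P.Msg) ∈ P.pastA A → t' ≠ t → ¬ P.SharesInput t t')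

variable {P}

theorem ConfN.gen (n : ℕ) (S : Set P.Msg) : P.ConfN n S P.genesis := by
  cases n with
  | zero => rfl
  | succ n => exact Or.inl rfl

theorem ConfN.mono {n : ℕ} : ∀ {m : ℕ}, n ≤ m → ∀ {S S' : Set P.Msg}, S ⊆ S' → ∀ {t},
    P.ConfN n S t → P.ConfN m S' t := by
  induction n with
  | zero =>
    intro m _ S S' _ t h
    have h' : t = P.genesis := h
    rw [h']; exact ConfN.gen _ _
  | succ n ih =>
    intro m hm S S' hS t h
    obtain ⟨m, rfl⟩ : ∃ k, m = k + 1 := ⟨m - 1, by omega⟩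
    rcases h with h | ⟨A, C, h1, h2, h3, h4, h5, h6⟩
    · exact Or.inl h
    · exact Or.inr ⟨A, C, fun a ha => hS (h1 a ha), fun o ho => ih (by omega) hS (h2 o ho), h3,
        fun u hu => ih (by omega) subset_rfl (h4 u hu), h5, h6⟩

theorem ConfN.prod {n : ℕ} {S : Set P.Msg} {t : P.Tx} (h : P.ConfN n S t) {o : P.Out}
    (ho : P.spends t o) : P.ConfN n S (P.producer o) := by
  cases n with
  | zero =>
    have h' : t = P.genesis := h
    subst h'; exact absurd ho (P.genesis_no_inputs o)
  | succ n =>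
    rcases h with rfl | ⟨A, C, h1, h2, h3, h4, h5, h6⟩
    · exact absurd ho (P.genesis_no_inputs o)
    · exact (h2 o ho).mono (by omega) subset_rfl

theorem ConfN.via {n : ℕ} {S : Set P.Msg} {t : P.Tx} (h : P.ConfN n S t) (ht : t ≠ P.genesis) :
    ∃ k A, n = k + 1 ∧ (∀ a ∈ A, (Sum.inr a : P.Msg) ∈ S) ∧ P.ViaN k A t := by
  cases n with
  | zero => exact absurd h ht
  | succ n =>
    rcases h with rfl | ⟨A, C, h1, h2, h3, h4, h5, h6⟩
    · exact absurd rfl ht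
    · exact ⟨n, A, rfl, h1, h3, ⟨C, h4, h5⟩, h6⟩

theorem exists_uniform {α : Type} [Finite α] (Q : α → Prop) (R : ℕ → α → Prop)
    (hmono : ∀ n m a, n ≤ m → R n a → R m a) (h : ∀ a, Q a → ∃ n, R n a) :
    ∃ n, ∀ a, Q a → R n a := by
  have := Fintype.ofFinite α
  choose! f hf using h
  exact ⟨Finset.univ.sup f, fun a ha =>
    hmono _ _ a (Finset.le_sup (f := f) (Finset.mem_univ a)) (hf a ha)⟩

theorem ConfirmedIn.exists_confN {S : Set P.Msg} {t : P.Tx} (h : P.ConfirmedIn S t) :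
    ∃ n, P.ConfN n S t := by
  induction h with
  | genesis S => exact ⟨0, rfl⟩
  | confirm S t A C h1 h2 h3 h4 h5 h6 ih2 ih4 =>
    obtain ⟨n, hn⟩ := exists_uniform (fun o => P.spends t o)
      (fun n o => P.ConfN n S (P.producer o)) (fun n m o hnm h => h.mono hnm subset_rfl) ih2
    obtain ⟨m, hm⟩ := exists_uniform (fun u => u ∈ C)
      (fun n u => P.ConfN n (P.pastA A) u) (fun n m o hnm h => h.mono hnm subset_rfl) ih4
    exact ⟨max n m + 1, Or.inr ⟨A, C, h1,
      fun o ho => (hn o ho).mono (le_max_left _ _) subset_rfl, h3,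
      fun u hu => (hm u hu).mono (le_max_right _ _) subset_rfl, h5, h6⟩⟩

theorem ConfirmsVia.exists_viaN {A : Finset P.Ack} {t : P.Tx} (h : P.ConfirmsVia A t) :
    ∃ n, P.ViaN n A t := by
  obtain ⟨_, h3, ⟨C, h4, h5⟩, h6⟩ := h
  obtain ⟨m, hm⟩ := exists_uniform (fun u => u ∈ C)
      (fun n u => P.ConfN n (P.pastA A) u) (fun n m o hnm h => h.mono hnm subset_rfl)
      (fun u hu => (h4 u hu).exists_confN)
  exact ⟨m, h3, ⟨C, hm, h5⟩, h6⟩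

theorem ConfirmedIn.mono {S : Set P.Msg} {t : P.Tx} (h : P.ConfirmedIn S t) :
    ∀ {S' : Set P.Msg}, S ⊆ S' → P.ConfirmedIn S' t := by
  induction h with
  | genesis S => intro S' _; exact .genesis _
  | confirm S t A C h1 h2 h3 h4 h5 h6 ih2 ih4 =>
    intro S' hS
    exact .confirm _ t A C (fun a ha => hS (h1 a ha)) (fun o ho => ih2 o ho hS) h3 h4 h5 h6

theorem M_nonneg : 0 ≤ P.M := by
  rw [← P.genesis_M]
  exact Finset.sum_nonneg fun o _ => by split_ifs; exacts [P.value_nonneg o, le_rfl]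

theorem mem_pastA {A : Finset P.Ack} {m : P.Msg} :
    m ∈ P.pastA A ↔ ∃ a ∈ A, Relation.ReflTransGen P.ref (Sum.inr a) m := by
  simp [pastA, past]

theorem pastA_sub {A B : Finset P.Ack} (h : ∀ a ∈ A, (Sum.inr a : P.Msg) ∈ P.pastA B) :
    P.pastA A ⊆ P.pastA B := by
  intro m hm
  obtain ⟨a, ha, hr⟩ := mem_pastA.1 hm
  obtain ⟨b, hb, hr'⟩ := mem_pastA.1 (h a ha)
  exact mem_pastA.2 ⟨b, hb, hr'.trans hr⟩

theorem nonempty_of_stake {A : Finset P.Ack} {C : Set P.Tx} {S : Set P.Msg}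
    (h : (2 / 3 : ℚ) * P.M < ∑ v ∈ A.image P.ackValidator, P.stakeWith C S v) : A.Nonempty := by
  rw [Finset.nonempty_iff_ne_empty]
  rintro rfl
  have := P.M_nonneg
  simp at h
  linarith

theorem ViaN.nonempty {n : ℕ} {A : Finset P.Ack} {t : P.Tx} (h : P.ViaN n A t) : A.Nonempty := by
  obtain ⟨_, ⟨C, _, h⟩, _⟩ := h
  exact nonempty_of_stake h

theorem ViaN.mem_past {n : ℕ} {A : Finset P.Ack} {t : P.Tx} (h : P.ViaN n A t) :
    (Sum.inl t : P.Msg) ∈ P.pastA A := by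
  obtain ⟨a, ha⟩ := h.nonempty
  exact mem_pastA.2 ⟨a, ha, .single (P.ref_signs a t (h.1 a ha))⟩

theorem Execution.le_of_reach (E : P.Execution) {m m' : P.Msg}
    (h : Relation.ReflTransGen P.ref m m') : E.time m' ≤ E.time m := by
  induction h with
  | refl => exact le_rfl
  | tail _ h ih => exact (E.respects _ _ h).le.trans ih

theorem advIn_le (t : P.Tx) (ht : t ≠ P.genesis) : P.advInputValue t ≤ P.txValue t := by
  unfold advInputValue txValue
  rw [P.value_conserved t ht]
  refine Finset.sum_le_sum fun o _ => ?_
  have := P.value_nonneg o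
  split_ifs <;> first | tauto | linarith

theorem advIn_nonneg (t : P.Tx) : 0 ≤ P.advInputValue t :=
  Finset.sum_nonneg fun o _ => by split_ifs; exacts [P.value_nonneg o, le_rfl]

variable (P) in
/-- upper bound for the adversary stake using adversary transactions in `D` -/
noncomputable def advUp (D : Set P.Tx) : ℚ :=
  (∑ o : P.Out,
      if P.producer o = P.genesis ∧ ¬ P.honest (P.delegatedTo o) then P.value o else 0)
    + ∑ t : P.Tx, if t ≠ P.genesis ∧ ¬ P.honest (P.txValidator t) ∧ t ∈ D
        then P.txValue t - P.advInputValue t else 0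

theorem advUp_mono {D D' : Set P.Tx} (h : ∀ d ∈ D, d ≠ P.genesis → d ∈ D') :
    P.advUp D ≤ P.advUp D' := by
  unfold advUp
  gcongr with t _
  by_cases ht : t = P.genesis
  · simp [ht]
  have := advIn_le t ht
  have := h t
  split_ifs <;> first | tauto | linarith

/-- the sub-DAG keeping only the transactions in `D` -/
noncomputable def sub (P : ABC) (D : Set P.Tx) (hg : P.genesis ∈ D)
    (hD : ∀ t ∈ D, ∀ o, P.spends t o → P.producer o ∈ D) : ABC where
  Val := P.Val
  Tx := {t // t ∈ D}
  Ack := P.Ack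
  Out := {o // P.producer o ∈ D}
  M := P.M
  value o := P.value o.1
  value_nonneg o := P.value_nonneg o.1
  producer o := ⟨P.producer o.1, o.2⟩
  spends t o := P.spends t.1 o.1
  txValidator t := P.txValidator t.1
  delegatedTo o := P.delegatedTo o.1
  genesis := ⟨P.genesis, hg⟩
  genesis_no_inputs o := P.genesis_no_inputs o.1
  delegated_eq o h := P.delegated_eq o.1 (fun h' => h (Subtype.ext h'))
  value_conserved t ht := by
    have ht' : t.1 ≠ P.genesis := fun h => ht (Subtype.ext h)
    simp only [Subtype.ext_iff]
    rw [sum_sub_eq (fun o => P.producer o ∈ D)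
        (fun o => if P.producer o = t.1 then P.value o else 0),
      sum_sub_eq (fun o => P.producer o ∈ D)
        (fun o => if P.spends t.1 o then P.value o else 0)]
    · exact P.value_conserved t.1 ht'
    · intro o ho
      rw [if_neg]; intro h; exact ho (hD _ t.2 _ h)
    · intro o ho
      rw [if_neg]; intro h; rw [h] at ho; exact ho t.2
  genesis_M := by
    simp only [Subtype.ext_iff]
    rw [sum_sub_eq (fun o => P.producer o ∈ D)
        (fun o => if P.producer o = P.genesis then P.value o else 0)]
    · exact P.genesis_M
    · intro o ho
      rw [if_neg]; intro h; rw [h] at ho; exact ho hg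
  ackValidator := P.ackValidator
  ackSigns a t := P.ackSigns a t.1
  ref m m' := Relation.TransGen P.ref (Sum.map Subtype.val id m) (Sum.map Subtype.val id m')
  ref_inputs t o h := .single (P.ref_inputs _ _ h)
  ref_signs a t h := .single (P.ref_signs _ _ h)
  ref_acyclic m h := by
    apply P.ref_acyclic (Sum.map Subtype.val id m)
    have : ∀ m', Relation.TransGen (fun m m' : {t // t ∈ D} ⊕ P.Ack =>
      Relation.TransGen P.ref (Sum.map Subtype.val id m) (Sum.map Subtype.val id m')) m m' →
      Relation.TransGen P.ref (Sum.map Subtype.val id m) (Sum.map Subtype.val id m') := by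
      intro m' h
      induction h with
      | single h => exact h
      | tail _ h ih => exact ih.trans h
    exact this m h
  honest := P.honest

section
variable {D : Set P.Tx} {hg : P.genesis ∈ D}
    {hD : ∀ t ∈ D, ∀ o, P.spends t o → P.producer o ∈ D}

/-- embedding of the messages of the sub-DAG -/
def emb (m : (P.sub D hg hD).Msg) : P.Msg := Sum.map Subtype.val id m

theorem emb_inj : Function.Injective (emb (D := D) (hg := hg) (hD := hD)) :=
  Sum.map_injective.2 ⟨Subtype.val_injective, Function.injective_id⟩

theorem sub_reach {m m' : (P.sub D hg hD).Msg} :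
    Relation.ReflTransGen (P.sub D hg hD).ref m m' ↔
      Relation.ReflTransGen P.ref (emb m) (emb m') := by
  constructor
  · intro h
    induction h with
    | refl => exact .refl
    | tail _ h ih => exact ih.trans (Relation.TransGen.to_reflTransGen h)
  · intro h
    rcases Relation.reflTransGen_iff_eq_or_transGen.1 h with h | h
    · rw [emb_inj h]
    · exact .single h

theorem sub_pastA (A : Finset P.Ack) :
    (P.sub D hg hD).pastA A = {m | emb m ∈ P.pastA A} := by
  ext m
  refine (mem_pastA (P := P.sub D hg hD)).trans (Iff.trans ?_ (mem_pastA (P := P)).symm)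
  exact exists_congr fun a => and_congr_right fun _ => sub_reach

theorem sub_stake (C : Set P.Tx) (hC : C ⊆ D) (S : Set P.Msg) (v : P.Val) :
    P.stakeWith C S v ≤
      (P.sub D hg hD).stakeWith {t | t.1 ∈ C} {m | emb m ∈ S} v := by
  unfold stakeWith
  rw [← sum_sub_eq (fun o => P.producer o ∈ D)]
  · refine Finset.sum_le_sum fun o _ => ?_
    have hnn := P.value_nonneg o.1
    by_cases h : P.producer o.1 ∈ C ∧ P.delegatedTo o.1 = v ∧ ¬ P.SpentIn S o.1
    · rw [if_pos h, if_pos]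
      · exact le_rfl
      · refine ⟨h.1, h.2.1, ?_⟩
        rintro ⟨t, ht, hs⟩
        exact h.2.2 ⟨t.1, ht, hs⟩
    · rw [if_neg h]
      split_ifs
      · exact hnn
      · exact le_rfl
  · intro o ho
    rw [if_neg]; intro h; exact ho (hC h.1)

theorem sub_confirmed {n : ℕ} {A : Finset P.Ack} (hDe : D = {d | P.ConfN n (P.pastA A) d}) :
    ∀ k ≤ n, ∀ S' ⊆ P.pastA A, ∀ t, P.ConfN k S' t → ∀ ht : t ∈ D,
      (P.sub D hg hD).ConfirmedIn {m | emb m ∈ S'} ⟨t, ht⟩ := by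
  intro k
  induction k with
  | zero =>
    intro _ S' _ t h ht
    have h' : t = P.genesis := h
    subst h'
    exact ConfirmedIn.genesis (P := P.sub D hg hD) _
  | succ k ih =>
    intro hk S' hS' t h ht
    rcases h with rfl | ⟨B, C, h1, h2, h3, h4, h5, h6⟩
    · exact ConfirmedIn.genesis (P := P.sub D hg hD) _
    · have hBA : P.pastA B ⊆ P.pastA A := pastA_sub fun a ha => hS' (h1 a ha)
      have hCD : C ⊆ D := fun u hu => by
        rw [hDe]; exact (h4 u hu).mono (by omega) hBA
      refine ConfirmedIn.confirm (P := P.sub D hg hD) _ _ B {u | u.1 ∈ C} h1 ?_ h3 ?_ ?_ ?_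
      · intro o ho
        exact ih (by omega) S' hS' _ (h2 o.1 ho) o.2
      · intro u hu
        rw [sub_pastA]
        exact ih (by omega) _ hBA _ (h4 u.1 hu) u.2
      · rw [sub_pastA]
        refine lt_of_lt_of_le h5 (Finset.sum_le_sum fun v _ => sub_stake C hCD _ v)
      · rintro t' ht' hne ⟨o, ho1, ho2⟩
        rw [sub_pastA] at ht'
        exact h6 t'.1 ht' (fun h => hne (Subtype.ext h)) ⟨o.1, ho1, ho2⟩

theorem sub_advStake (S : Set (P.sub D hg hD).Msg) :
    (P.sub D hg hD).advStake S ≤ P.advUp D := by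
  have hin : ∀ t : {t // t ∈ D},
      (P.sub D hg hD).advInputValue t = P.advInputValue t.1 := by
    intro t
    unfold advInputValue
    rw [← sum_sub_eq (fun o => P.producer o ∈ D)]
    · rfl
    · intro o ho
      rw [if_neg]; intro h; exact ho (hD _ t.2 _ h.1)
  have hv : ∀ t : {t // t ∈ D}, (P.sub D hg hD).txValue t = P.txValue t.1 := by
    intro t
    unfold txValue
    rw [← sum_sub_eq (fun o => P.producer o ∈ D)]
    · refine Finset.sum_congr rfl fun o _ => ?_
      exact if_congr Subtype.ext_iff rfl rfl
    · intro o ho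
      rw [if_neg]; intro h; rw [h] at ho; exact ho t.2
  unfold advStake advUp
  have h2 : 0 ≤ (∑ t : (P.sub D hg hD).Tx,
        if t ≠ (P.sub D hg hD).genesis ∧ (P.sub D hg hD).honest ((P.sub D hg hD).txValidator t)
          ∧ (P.sub D hg hD).ConfirmedIn S t
        then (P.sub D hg hD).advInputValue t else 0) :=
    Finset.sum_nonneg fun t _ => by
      split_ifs
      · exact advIn_nonneg t
      · exact le_rfl
  have h1 : (∑ o : (P.sub D hg hD).Out,
      if (P.sub D hg hD).producer o = (P.sub D hg hD).genesis ∧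
        ¬ (P.sub D hg hD).honest ((P.sub D hg hD).delegatedTo o)
      then (P.sub D hg hD).value o else 0) = ∑ o : P.Out,
      if P.producer o = P.genesis ∧ ¬ P.honest (P.delegatedTo o) then P.value o else 0 := by
    rw [← sum_sub_eq (fun o => P.producer o ∈ D)]
    · refine Finset.sum_congr rfl fun o _ => ?_
      exact if_congr (and_congr_left fun _ => Subtype.ext_iff) rfl rfl
    · intro o ho
      rw [if_neg]; intro h; rw [h.1] at ho; exact ho hg
  have h3 : (∑ t : (P.sub D hg hD).Tx,
        if t ≠ (P.sub D hg hD).genesis ∧ ¬ (P.sub D hg hD).honest ((P.sub D hg hD).txValidator t)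
          ∧ (Sum.inl t : (P.sub D hg hD).Msg) ∈ S
        then (P.sub D hg hD).txValue t - (P.sub D hg hD).advInputValue t else 0) ≤
      ∑ t : P.Tx, if t ≠ P.genesis ∧ ¬ P.honest (P.txValidator t) ∧ t ∈ D
        then P.txValue t - P.advInputValue t else 0 := by
    rw [← sum_sub_eq (fun t => t ∈ D)]
    · refine Finset.sum_le_sum fun t _ => ?_
      have e : (P.sub D hg hD).txValue t - (P.sub D hg hD).advInputValue t =
          P.txValue t.1 - P.advInputValue t.1 := congrArg₂ (· - ·) (hv t) (hin t)
      refine le_of_eq_of_le (if_congr Iff.rfl e rfl) ?_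
      by_cases ht : t.1 = P.genesis
      · rw [if_neg, if_neg]
        · exact fun h => h.1 ht
        · exact fun h => h.1 (Subtype.ext ht)
      have hle := advIn_le t.1 ht
      by_cases h : t.1 ≠ P.genesis ∧ ¬ P.honest (P.txValidator t.1) ∧ t.1 ∈ D
      · rw [if_pos h]
        split_ifs <;> linarith
      · rw [if_neg h, if_neg]
        rintro ⟨_, h', _⟩
        exact h ⟨ht, h', t.2⟩
    · intro t ht
      rw [if_neg]; intro h; exact ht h.2.2
  linarith

theorem sub_depends {t u : (P.sub D hg hD).Tx} (h : (P.sub D hg hD).Depends t u) :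
    P.Depends t.1 u.1 := by
  induction h with
  | refl => exact .refl
  | tail _ h ih =>
    obtain ⟨o, h1, h2⟩ := h
    exact ih.tail ⟨o.1, h1, congrArg Subtype.val h2⟩

theorem sub_producible (E : P.Execution) (hchain : P.HonestChained)
    (hnocs : P.HonestNoConflictSign) (hadv : P.advUp D < P.M / 3) :
    (P.sub D hg hD).Producible := by
  refine ⟨?_, ?_, ⟨fun m => E.time (emb m), fun _ _ h => emb_inj (E.inj h), ?_⟩, ?_⟩
  · intro a₁ a₂ h1 h2
    rw [sub_reach, sub_reach]
    exact hchain a₁ a₂ h1 h2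
  · rintro a₁ a₂ t₁ t₂ h1 h2 h3 h4 h5 ⟨u₁, u₂, d1, d2, hne, o, ho1, ho2⟩
    exact hnocs a₁ a₂ t₁.1 t₂.1 h1 h2 h3 h4 (fun h => h5 (Subtype.ext h))
      ⟨u₁.1, u₂.1, sub_depends d1, sub_depends d2, fun h => hne (Subtype.ext h), o.1, ho1, ho2⟩
  · intro m m' h
    have h : Relation.TransGen P.ref (emb m) (emb m') := h
    obtain ⟨b, hb, hr⟩ := Relation.TransGen.head'_iff.1 h
    exact lt_of_le_of_lt (E.le_of_reach hr) (E.respects _ _ hb)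
  · intro n
    exact lt_of_le_of_lt (sub_advStake _) hadv

end

/-- by minimality, a proper set of confirmed transactions has no double spend -/
theorem no_share (E : P.Execution) (hchain : P.HonestChained)
    (hnocs : P.HonestNoConflictSign)
    (hmin : ∀ G' : ABC, G'.Producible → G'.HasDoubleSpend →
      Fintype.card P.Tx ≤ Fintype.card G'.Tx)
    (n : ℕ) (A : Finset P.Ack) (hadv : P.advUp {d | P.ConfN n (P.pastA A) d} < P.M / 3)
    (s : P.Tx) (hs : ¬ P.ConfN n (P.pastA A) s)
    (u w : P.Tx) (hu : P.ConfN n (P.pastA A) u) (hw : P.ConfN n (P.pastA A) w) (hne : u ≠ w) :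
    ¬ P.SharesInput u w := by
  rintro ⟨o, ho1, ho2⟩
  have hg : P.genesis ∈ {d | P.ConfN n (P.pastA A) d} := ConfN.gen _ _
  have hD : ∀ t ∈ {d | P.ConfN n (P.pastA A) d}, ∀ o, P.spends t o →
      P.producer o ∈ {d | P.ConfN n (P.pastA A) d} := fun t ht o ho => ConfN.prod ht ho
  have hc : ∀ t (ht : P.ConfN n (P.pastA A) t),
      (P.sub _ hg hD).Confirmed ⟨t, ht⟩ := fun t ht =>
    (sub_confirmed rfl n le_rfl _ subset_rfl t ht ht).mono (Set.subset_univ _)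
  have := hmin (P.sub _ hg hD) (sub_producible E hchain hnocs hadv)
    ⟨⟨u, hu⟩, ⟨w, hw⟩, hc u hu, hc w hw, ⟨u, hu⟩, ⟨w, hw⟩, .refl, .refl,
      fun h => hne (congrArg Subtype.val h), ⟨o, hD u hu o ho1⟩, ho1, ho2⟩
  have hlt : Fintype.card {t // t ∈ {d | P.ConfN n (P.pastA A) d}} < Fintype.card P.Tx :=
    Fintype.card_subtype_lt (x := s) hs
  have heq : Fintype.card (P.sub _ hg hD).Tx =
      Fintype.card {t // t ∈ {d | P.ConfN n (P.pastA A) d}} :=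
    @Fintype.card_congr _ _ (_) (_) (Equiv.refl {t // t ∈ {d | P.ConfN n (P.pastA A) d}})
  omega

/-- conservation of value, weighted -/
theorem spent_sum (D : Set P.Tx)
    (hns : ∀ u ∈ D, ∀ w ∈ D, u ≠ w → ¬ P.SharesInput u w) (q : P.Out → Prop) :
    (∑ o : P.Out, if (∃ d ∈ D, P.spends d o) ∧ q o then P.value o else 0) =
      ∑ t : P.Tx, if t ∈ D then (∑ o : P.Out, if P.spends t o ∧ q o then P.value o else 0)
        else 0 := by
  have : ∀ t : P.Tx, (if t ∈ D then (∑ o : P.Out, if P.spends t o ∧ q o then P.value o else 0)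
      else 0) = ∑ o : P.Out, if t ∈ D ∧ P.spends t o ∧ q o then P.value o else 0 := by
    intro t
    split_ifs with h <;> simp [h]
  simp_rw [this]
  rw [Finset.sum_comm]
  refine Finset.sum_congr rfl fun o _ => ?_
  split_ifs with h
  · obtain ⟨⟨d, hd, hs⟩, hq⟩ := h
    rw [Finset.sum_eq_single d]
    · rw [if_pos ⟨hd, hs, hq⟩]
    · intro b _ hb
      rw [if_neg]
      rintro ⟨h1, h2, _⟩
      exact hns b h1 d hd hb ⟨o, h2, hs⟩
    · simp
  · symm
    refine Finset.sum_eq_zero fun t _ => ?_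
    rw [if_neg]
    rintro ⟨h1, h2, h3⟩
    exact h ⟨⟨t, h1, h2⟩, h3⟩

theorem made_sum (D : Set P.Tx) (q : P.Out → Prop) :
    (∑ o : P.Out, if P.producer o ∈ D ∧ q o then P.value o else 0) =
      ∑ t : P.Tx, if t ∈ D then (∑ o : P.Out, if P.producer o = t ∧ q o then P.value o else 0)
        else 0 := by
  have : ∀ t : P.Tx, (if t ∈ D then
      (∑ o : P.Out, if P.producer o = t ∧ q o then P.value o else 0)
      else 0) = ∑ o : P.Out, if t = P.producer o then
        (if t ∈ D ∧ q o then P.value o else 0) else 0 := by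
    intro t
    split_ifs with h
    · refine Finset.sum_congr rfl fun o _ => ?_
      by_cases h' : t = P.producer o
      · simp [h'.symm, h]
      · simp [h', Ne.symm h']
    · simp [h]
  simp_rw [this]
  rw [Finset.sum_comm]
  refine Finset.sum_congr rfl fun o _ => ?_
  simp

variable (P) in
/-- outputs of `D` not spent by `D` -/
def Uns (D : Set P.Tx) (o : P.Out) : Prop :=
  P.producer o ∈ D ∧ ¬ ∃ d ∈ D, P.spends d o

theorem uns_sum (D : Set P.Tx) (hD : ∀ t ∈ D, ∀ o, P.spends t o → P.producer o ∈ D)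
    (hns : ∀ u ∈ D, ∀ w ∈ D, u ≠ w → ¬ P.SharesInput u w) (q : P.Out → Prop) :
    (∑ o : P.Out, if P.Uns D o ∧ q o then P.value o else 0) =
      ∑ t : P.Tx, if t ∈ D then
        (∑ o : P.Out, if P.producer o = t ∧ q o then P.value o else 0) -
        (∑ o : P.Out, if P.spends t o ∧ q o then P.value o else 0) else 0 := by
  have h1 := spent_sum D hns q
  have h2 := made_sum D q
  have h3 : (∑ o : P.Out, if P.Uns D o ∧ q o then P.value o else 0) =
      (∑ o : P.Out, if P.producer o ∈ D ∧ q o then P.value o else 0) -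
      (∑ o : P.Out, if (∃ d ∈ D, P.spends d o) ∧ q o then P.value o else 0) := by
    rw [← Finset.sum_sub_distrib]
    refine Finset.sum_congr rfl fun o _ => ?_
    by_cases hs : ∃ d ∈ D, P.spends d o
    · have hp : P.producer o ∈ D := by
        obtain ⟨d, hd, h⟩ := hs
        exact hD d hd o h
      have : ¬ P.Uns D o := fun h => h.2 hs
      simp only [hs, hp, this]; simp
    · by_cases hp : P.producer o ∈ D
      · have : P.Uns D o := ⟨hp, hs⟩
        simp only [hs, hp, this]; simp
      · have : ¬ P.Uns D o := fun h => hp h.1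
        simp only [hs, hp, this]; simp
  rw [h3, h1, h2, ← Finset.sum_sub_distrib]
  refine Finset.sum_congr rfl fun t _ => ?_
  split_ifs <;> simp

theorem uns_total (D : Set P.Tx) (hg : P.genesis ∈ D)
    (hD : ∀ t ∈ D, ∀ o, P.spends t o → P.producer o ∈ D)
    (hns : ∀ u ∈ D, ∀ w ∈ D, u ≠ w → ¬ P.SharesInput u w) :
    (∑ o : P.Out, if P.Uns D o then P.value o else 0) = P.M := by
  have h := uns_sum D hD hns (fun _ => True)
  simp only [and_true] at h
  rw [h, Finset.sum_eq_single P.genesis]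
  · rw [if_pos hg, P.genesis_M]
    simp [P.genesis_no_inputs]
  · intro t _ ht
    rw [P.value_conserved t ht]; simp
  · simp

theorem uns_adv (D : Set P.Tx) (hg : P.genesis ∈ D)
    (hD : ∀ t ∈ D, ∀ o, P.spends t o → P.producer o ∈ D)
    (hns : ∀ u ∈ D, ∀ w ∈ D, u ≠ w → ¬ P.SharesInput u w) :
    (∑ o : P.Out, if P.Uns D o ∧ ¬ P.honest (P.delegatedTo o) then P.value o else 0)
      ≤ P.advUp D := by
  have hsum : (∑ o : P.Out, if P.Uns D o ∧ ¬ P.honest (P.delegatedTo o) then P.value o else 0) =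
      ∑ t : P.Tx, if t ∈ D then
        (∑ o : P.Out, if P.producer o = t ∧ ¬ P.honest (P.delegatedTo o) then P.value o else 0) -
        (∑ o : P.Out, if P.spends t o ∧ ¬ P.honest (P.delegatedTo o) then P.value o else 0)
        else 0 := by
    convert uns_sum D hD hns (fun o => ¬ P.honest (P.delegatedTo o))
  rw [hsum, advUp]
  rw [← Finset.add_sum_erase _ _ (Finset.mem_univ P.genesis)]
  rw [← Finset.add_sum_erase (f := fun t => if t ≠ P.genesis ∧ ¬ P.honest (P.txValidator t) ∧ t ∈ D
        then P.txValue t - P.advInputValue t else 0) _ (Finset.mem_univ P.genesis)]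
  rw [if_pos hg]
  have h0 : (∑ o : P.Out, if P.spends P.genesis o ∧ ¬ P.honest (P.delegatedTo o)
      then P.value o else 0) = 0 := by simp [P.genesis_no_inputs]
  rw [h0]
  simp only [ne_eq, not_true_eq_false, false_and, if_false, zero_add, sub_zero]
  gcongr with t ht
  have ht : t ≠ P.genesis := Finset.ne_of_mem_erase ht
  by_cases hd : t ∈ D
  swap
  · simp [hd]
  have hin : (∑ o : P.Out, if P.spends t o ∧ ¬ P.honest (P.delegatedTo o)
      then P.value o else 0) = P.advInputValue t := rfl
  rw [if_pos hd, hin]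
  by_cases hh : P.honest (P.txValidator t)
  · have : (∑ o : P.Out, if P.producer o = t ∧ ¬ P.honest (P.delegatedTo o)
      then P.value o else 0) = 0 := by
      refine Finset.sum_eq_zero fun o _ => ?_
      rw [if_neg]
      rintro ⟨rfl, h⟩
      rw [P.delegated_eq o ht] at h
      exact h hh
    rw [this, if_neg (by tauto)]
    have := advIn_nonneg t
    linarith
  · rw [if_pos ⟨ht, hh, hd⟩]
    have : (∑ o : P.Out, if P.producer o = t ∧ ¬ P.honest (P.delegatedTo o)
      then P.value o else 0) ≤ P.txValue t := by
      refine Finset.sum_le_sum fun o _ => ?_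
      have := P.value_nonneg o
      split_ifs <;> first | tauto | linarith
    linarith

theorem stake_le (D C : Set P.Tx) (S : Set P.Msg) (V : Finset P.Val) (hC : C ⊆ D)
    (hDS : ∀ d ∈ D, d ≠ P.genesis → (Sum.inl d : P.Msg) ∈ S) :
    ∑ v ∈ V, P.stakeWith C S v ≤
      ∑ o : P.Out, if P.Uns D o ∧ P.delegatedTo o ∈ V then P.value o else 0 := by
  unfold stakeWith
  rw [Finset.sum_comm]
  refine Finset.sum_le_sum fun o _ => ?_
  have hnn := P.value_nonneg o
  by_cases h : P.producer o ∈ C ∧ ¬ P.SpentIn S o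
  · have hU : P.Uns D o := by
      refine ⟨hC h.1, ?_⟩
      rintro ⟨d, hd, hs⟩
      refine h.2 ⟨d, hDS d hd ?_, hs⟩
      rintro rfl
      exact P.genesis_no_inputs o hs
    simp [h, hU]
  · have : ∀ v, ¬ (P.producer o ∈ C ∧ P.delegatedTo o = v ∧ ¬ P.SpentIn S o) := by tauto
    simp only [this, if_false, Finset.sum_const_zero]
    split_ifs
    · exact hnn
    · exact le_rfl

theorem quorum (D C C₀ : Set P.Tx) (S S₀ : Set P.Msg) (V V₀ : Finset P.Val)
    (hg : P.genesis ∈ D)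
    (hD : ∀ t ∈ D, ∀ o, P.spends t o → P.producer o ∈ D)
    (hns : ∀ u ∈ D, ∀ w ∈ D, u ≠ w → ¬ P.SharesInput u w)
    (hC : C ⊆ D) (hC₀ : C₀ ⊆ D)
    (hDS : ∀ d ∈ D, d ≠ P.genesis → (Sum.inl d : P.Msg) ∈ S)
    (hDS₀ : ∀ d ∈ D, d ≠ P.genesis → (Sum.inl d : P.Msg) ∈ S₀)
    (h : (2 / 3 : ℚ) * P.M < ∑ v ∈ V, P.stakeWith C S v)
    (h₀ : (2 / 3 : ℚ) * P.M < ∑ v ∈ V₀, P.stakeWith C₀ S₀ v)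
    (hadv : P.advUp D < P.M / 3) :
    ∃ v ∈ V, v ∈ V₀ ∧ P.honest v := by
  by_contra! hcon
  have e1 := stake_le D C S V hC hDS
  have e2 := stake_le D C₀ S₀ V₀ hC₀ hDS₀
  have e3 := uns_total D hg hD hns
  have e4 := uns_adv D hg hD hns
  have e5 : (∑ o : P.Out, if P.Uns D o ∧ P.delegatedTo o ∈ V then P.value o else 0) +
      (∑ o : P.Out, if P.Uns D o ∧ P.delegatedTo o ∈ V₀ then P.value o else 0) ≤
      (∑ o : P.Out, if P.Uns D o then P.value o else 0) +
      (∑ o : P.Out, if P.Uns D o ∧ ¬ P.honest (P.delegatedTo o) then P.value o else 0) := by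
    rw [← Finset.sum_add_distrib, ← Finset.sum_add_distrib]
    refine Finset.sum_le_sum fun o _ => ?_
    have hnn := P.value_nonneg o
    have := hcon (P.delegatedTo o)
    by_cases hU : P.Uns D o
    · by_cases h1 : P.delegatedTo o ∈ V <;> by_cases h2 : P.delegatedTo o ∈ V₀ <;>
        by_cases h3 : P.honest (P.delegatedTo o) <;> simp [hU, h1, h2, h3, hnn]
      exact absurd h3 (this h1 h2)
    · simp [hU]
  linarith

theorem main_pair (E : P.Execution) (hchain : P.HonestChained)
    (hnocs : P.HonestNoConflictSign)
    (hmin : ∀ G' : ABC, G'.Producible → G'.HasDoubleSpend →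
      Fintype.card P.Tx ≤ Fintype.card G'.Tx)
    (n₀ : ℕ) (hadv : P.advUp {d | E.time (Sum.inl d) < n₀} < P.M / 3) (N : ℕ) :
    ∀ n m, n + m ≤ N → ∀ t A t₀ A₀, P.ViaN n A t → P.ViaN m A₀ t₀ → t₀ ≠ P.genesis →
      (∀ a ∈ A₀, E.time (Sum.inr a) ≤ n₀) →
      (Sum.inl t₀ : P.Msg) ∈ P.pastA A ∨ (Sum.inl t : P.Msg) ∈ P.pastA A₀ := by
  induction N using Nat.strong_induction_on with
  | _ N IH =>
  intro n m hnm t A t₀ A₀ hA hA₀ hne hn₀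
  by_contra! hcon
  obtain ⟨hc1, hc2⟩ := hcon
  have hpre : ∀ B : Finset P.Ack, (∀ a ∈ B, (Sum.inr a : P.Msg) ∈ P.pastA A₀) →
      ∀ a ∈ B, E.time (Sum.inr a) ≤ n₀ := by
    intro B hB a ha
    obtain ⟨b, hb, hr⟩ := mem_pastA.1 (hB a ha)
    exact (E.le_of_reach hr).trans (hn₀ b hb)
  -- confirmed in `past A`
  have hK0 : ∀ w, P.ConfN n (P.pastA A) w → w ≠ P.genesis → (Sum.inl w : P.Msg) ∈ P.pastA A := by
    intro w hw hwg
    obtain ⟨k, B, rfl, hB, hv⟩ := hw.via hwg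
    exact pastA_sub hB hv.mem_past
  have hK : ∀ w, P.ConfN n (P.pastA A) w → w ≠ P.genesis →
      (Sum.inl w : P.Msg) ∈ P.pastA A₀ := by
    intro w hw hwg
    obtain ⟨k, B, rfl, hB, hv⟩ := hw.via hwg
    rcases IH (k + m) (by omega) k m le_rfl w B t₀ A₀ hv hA₀ hne hn₀ with h | h
    · exact absurd (pastA_sub hB h) hc1
    · exact h
  have hL0 : ∀ w, P.ConfN m (P.pastA A₀) w → w ≠ P.genesis →
      (Sum.inl w : P.Msg) ∈ P.pastA A₀ := by
    intro w hw hwg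
    obtain ⟨k, B, rfl, hB, hv⟩ := hw.via hwg
    exact pastA_sub hB hv.mem_past
  have hL : ∀ w, P.ConfN m (P.pastA A₀) w → w ≠ P.genesis →
      (Sum.inl w : P.Msg) ∈ P.pastA A := by
    intro w hw hwg
    obtain ⟨k, B, rfl, hB, hv⟩ := hw.via hwg
    rcases IH (n + k) (by omega) n k le_rfl t A w B hA hv hwg (hpre B hB) with h | h
    · exact h
    · exact absurd (pastA_sub hB h) hc2
  have htime : ∀ w, (Sum.inl w : P.Msg) ∈ P.pastA A₀ → E.time (Sum.inl w) < n₀ := by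
    intro w hw
    obtain ⟨b, hb, hr⟩ := mem_pastA.1 hw
    have h1 := E.le_of_reach hr
    have h2 : E.time (Sum.inl w) ≠ E.time (Sum.inr b) := fun h => by
      have := E.inj h; cases this
    have := hn₀ b hb
    omega
  have hadvD : ∀ D : Set P.Tx, (∀ d ∈ D, d ≠ P.genesis → (Sum.inl d : P.Msg) ∈ P.pastA A₀) →
      P.advUp D < P.M / 3 := fun D hD =>
    lt_of_le_of_lt (advUp_mono fun d hd hdg => htime d (hD d hd hdg)) hadv
  have hKns := no_share E hchain hnocs hmin n A (hadvD _ hK) t₀ (fun h => hc1 (hK0 _ h hne))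
  have hLns := no_share E hchain hnocs hmin m A₀ (hadvD _ hL0) t₀ (fun h => hc1 (hL _ h hne))
  have hKL : ∀ w u, P.ConfN n (P.pastA A) w → P.ConfN m (P.pastA A₀) u → w ≠ u →
      ¬ P.SharesInput w u := by
    rintro w u hw hu hwu ⟨o, ho1, ho2⟩
    have hwg : w ≠ P.genesis := by rintro rfl; exact P.genesis_no_inputs o ho1
    have hug : u ≠ P.genesis := by rintro rfl; exact P.genesis_no_inputs o ho2
    obtain ⟨k, B, rfl, hB, hv⟩ := hw.via hwg
    obtain ⟨l, B', rfl, hB', hv'⟩ := hu.via hug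
    rcases IH (k + l) (by omega) k l le_rfl w B u B' hv hv' hug (hpre B' hB') with h | h
    · exact hv.2.2 u h hwu.symm ⟨o, ho1, ho2⟩
    · exact hv'.2.2 w h hwu ⟨o, ho2, ho1⟩
  obtain ⟨hs, ⟨C, hC, hst⟩, -⟩ := hA
  obtain ⟨hs₀, ⟨C₀, hC₀, hst₀⟩, -⟩ := hA₀
  obtain ⟨v, hv, hv₀, hh⟩ := quorum
    {d | P.ConfN n (P.pastA A) d ∨ P.ConfN m (P.pastA A₀) d} C C₀ (P.pastA A) (P.pastA A₀)
    (A.image P.ackValidator) (A₀.image P.ackValidator) (Or.inl (ConfN.gen _ _))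
    (fun t ht o ho => ht.imp (fun h => h.prod ho) (fun h => h.prod ho))
    (by
      rintro u (hu | hu) w (hw | hw) huw
      · exact hKns u w hu hw huw
      · exact hKL u w hu hw huw
      · rintro ⟨o, h1, h2⟩
        exact hKL w u hw hu huw.symm ⟨o, h2, h1⟩
      · exact hLns u w hu hw huw)
    (fun u hu => Or.inl (hC u hu)) (fun u hu => Or.inr (hC₀ u hu))
    (fun d hd hdg => hd.elim (fun h => hK0 d h hdg) (fun h => hL d h hdg))
    (fun d hd hdg => hd.elim (fun h => hK d h hdg) (fun h => hL0 d h hdg))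
    hst hst₀
    (hadvD _ (fun d hd hdg => hd.elim (fun h => hK d h hdg) (fun h => hL0 d h hdg)))
  obtain ⟨a, ha, rfl⟩ := Finset.mem_image.1 hv
  obtain ⟨a₀, ha₀, heq⟩ := Finset.mem_image.1 hv₀
  rcases hchain a a₀ hh heq.symm with h | h
  · exact hc1 (mem_pastA.2 ⟨a, ha, h.tail (P.ref_signs _ _ (hs₀ a₀ ha₀))⟩)
  · exact hc2 (mem_pastA.2 ⟨a₀, ha₀, h.tail (P.ref_signs _ _ (hs a ha))⟩)

theorem adv_first (E : P.Execution) (hadv : P.AdvBounded E) (t₀ : P.Tx) (A₀ : Finset P.Ack)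
    (hfirst : P.FirstConfirmed E t₀ A₀) :
    P.advUp {d | E.time (Sum.inl d) < P.latestAck E A₀} < P.M / 3 := by
  obtain ⟨hne, hvia, hmin⟩ := hfirst
  obtain ⟨k, hk⟩ := hvia.exists_viaN
  obtain ⟨a, ha⟩ := hk.nonempty
  have hpos : 0 < P.latestAck E A₀ := by
    have h1 := E.respects _ _ (P.ref_signs a t₀ (hk.1 a ha))
    have h2 : E.time (Sum.inr a) ≤ P.latestAck E A₀ :=
      Finset.le_sup (f := fun a => E.time (Sum.inr a)) ha
    omega
  have hnc : ∀ t, t ≠ P.genesis → ¬ P.ConfirmedIn (P.prefixAt E (P.latestAck E A₀ - 1)) t := by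
    intro t ht hc
    cases hc with
    | genesis => exact ht rfl
    | confirm _ _ A C h1 h2 h3 h4 h5 h6 =>
      have := hmin t A ht ⟨fun o ho => (h2 o ho).mono (Set.subset_univ _), h3, ⟨C, h4, h5⟩, h6⟩
      have h' : P.latestAck E A ≤ P.latestAck E A₀ - 1 := Finset.sup_le fun a ha => h1 a ha
      omega
  have h := hadv (P.latestAck E A₀ - 1)
  refine lt_of_le_of_lt (le_of_eq ?_) h
  unfold advUp advStake
  rw [Finset.sum_eq_zero (f := fun t => if t ≠ P.genesis ∧ P.honest (P.txValidator t) ∧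
    P.ConfirmedIn (P.prefixAt E (P.latestAck E A₀ - 1)) t then P.advInputValue t else 0), sub_zero]
  · congr 1
    refine Finset.sum_congr rfl fun t _ => ?_
    have hiff : t ∈ {d | E.time (Sum.inl d) < P.latestAck E A₀} ↔
        (Sum.inl t : P.Msg) ∈ P.prefixAt E (P.latestAck E A₀ - 1) := by
      simp only [prefixAt, Set.mem_setOf_eq]
      omega
    by_cases hp : t ≠ P.genesis ∧ ¬ P.honest (P.txValidator t) ∧
        (Sum.inl t : P.Msg) ∈ P.prefixAt E (P.latestAck E A₀ - 1)
    · rw [if_pos hp, if_pos ⟨hp.1, hp.2.1, hiff.2 hp.2.2⟩]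
    · rw [if_neg hp, if_neg (fun h => hp ⟨h.1, h.2.1, hiff.1 h.2.2⟩)]
  · intro t _
    rw [if_neg]
    rintro ⟨h1, _, h2⟩
    exact hnc t h1 h2

end ABC

/-- STATEMENT 5 (Lemma 3 of the paper): let `G` be a minimal transaction DAG
(fewest transactions among DAGs producible by the protocol) containing two
confirmed conflicting transactions, and let `t₀` be the first transaction
confirmed in `G` during the execution `E` (witnessed by the confirming ack set
`A₀` whose latest ack w.r.t. the time order is minimal).  Then for any
confirmed transaction `t` of `G` with confirming ack set `A`, either
`t₀ ∈ past A` or `t ∈ past A₀`. -/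
theorem ABC.first_confirmed_past_or (G : ABC) (E : G.Execution)
    (hchain : G.HonestChained) (hnocs : G.HonestNoConflictSign)
    (hadv : G.AdvBounded E) (hds : G.HasDoubleSpend)
    (hmin : ∀ G' : ABC, G'.Producible → G'.HasDoubleSpend →
      Fintype.card G.Tx ≤ Fintype.card G'.Tx)
    (t₀ : G.Tx) (A₀ : Finset G.Ack) (hfirst : G.FirstConfirmed E t₀ A₀)
    (t : G.Tx) (A : Finset G.Ack) (hA : G.ConfirmsVia A t) :
    (Sum.inl t₀ : G.Msg) ∈ G.pastA A ∨ (Sum.inl t : G.Msg) ∈ G.pastA A₀ := by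
  obtain ⟨n, hn⟩ := hA.exists_viaN
  obtain ⟨m, hm⟩ := hfirst.2.1.exists_viaN
  exact main_pair E hchain hnocs hmin (G.latestAck E A₀) (adv_first E hadv t₀ A₀ hfirst) (n + m)
    n m le_rfl t A t₀ A₀ hn hm hfirst.1
    (fun a ha => Finset.le_sup (f := fun a => E.time (Sum.inr a)) ha)
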